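/- Let (R,m) be an Artinian local commutative ring of prime characteristic p satisfying m^p = 0. If M is an arbitrary (not necessarily finitely generated) R-module such that Tor^R_j(M, ^{φ^r}R) = 0 for some integers j, r ≥ 1, then M has projective dimension strictly less than j. -/

import Mathlib

open CategoryTheory

universe u

/-- `R` viewed as a module over itself by restriction of scalars along a ring
endomorphism `f : R →+* R` (here `f` will be the `r`-th Frobenius power `a ↦ a ^ p ^ r`),
i.e. the module `^{φ^r}R` with action `a · b = f a * b = a ^ p ^ r * b`. -/
noncomputable abbrev frobMod {R : Type u} [CommRing R] (f : R →+* R) : ModuleCat.{u} R :=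
  (ModuleCat.restrictScalars f).obj (ModuleCat.of R R)

/-- An `R`-module `M` has projective dimension `< j` if it admits a projective
resolution `P_•` with `P_n = 0` for all `n ≥ j`. -/
def HasProjDimLT (R : Type u) [CommRing R] (M : Type u) [AddCommGroup M] [Module R M]
    (j : ℕ) : Prop :=
  ∃ P : ProjectiveResolution (ModuleCat.of R M),
    ∀ n, j ≤ n → Limits.IsZero (P.complex.X n)

namespace CategoryTheory.ProjectiveResolution

variable {C : Type*} [Category C] [Abelian C]

/-- The augmentation map of a projective resolution, as a morphism to the resolved object. -/
noncomputable def augmentation {Z : C} (P : ProjectiveResolution Z) : P.complex.X 0 ⟶ Z :=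
  P.π.f 0

instance {Z : C} (P : ProjectiveResolution Z) : Epi P.augmentation :=
  inferInstanceAs (Epi (P.π.f 0))

lemma d_comp_augmentation {Z : C} (P : ProjectiveResolution Z) :
    P.complex.d 1 0 ≫ P.augmentation = 0 :=
  P.complex_d_comp_π_f_zero

lemma exact_augmentation {Z : C} (P : ProjectiveResolution Z) :
    (ShortComplex.mk _ _ P.d_comp_augmentation).Exact :=
  P.exact₀

variable {S : ShortComplex C}

/-- The complex obtained by splicing a projective resolution of `S.X₁` with `S`. -/
noncomputable abbrev spliceComplex (S : ShortComplex C) (P : ProjectiveResolution S.X₁) :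
    ChainComplex C ℕ :=
  ChainComplex.augment P.complex (P.augmentation ≫ S.f) (by
    rw [← Category.assoc, d_comp_augmentation, Limits.zero_comp])

lemma spliceComplex_exactAt_succ (hS : S.ShortExact) (P : ProjectiveResolution S.X₁) (n : ℕ) :
    (spliceComplex S P).ExactAt (n + 1) := by
  rw [HomologicalComplex.exactAt_iff' _ (n + 2) (n + 1) n (by simp) (by simp)]
  cases n with
  | zero =>
    let φ : ShortComplex.mk _ _ P.d_comp_augmentation ⟶ (spliceComplex S P).sc' 2 1 0 :=
      { τ₁ := 𝟙 (P.complex.X 1)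
        τ₂ := 𝟙 (P.complex.X 0)
        τ₃ := S.f
        comm₁₂ := (Category.id_comp _).trans (Category.comp_id _).symm
        comm₂₃ := Category.id_comp _ }
    have : Epi φ.τ₁ := inferInstanceAs (Epi (𝟙 (P.complex.X 1)))
    have : IsIso φ.τ₂ := inferInstanceAs (IsIso (𝟙 (P.complex.X 0)))
    have : Mono φ.τ₃ := hS.mono_f
    exact (ShortComplex.exact_iff_of_epi_of_isIso_of_mono φ).1 P.exact_augmentation
  | succ n => exact P.exact_succ n

lemma augmentation_comp_comp (P : ProjectiveResolution S.X₁) :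
    (P.augmentation ≫ S.f) ≫ S.g = 0 := by
  rw [Category.assoc, S.zero, Limits.comp_zero]

lemma exact_augmentation_comp (hS : S.ShortExact) (P : ProjectiveResolution S.X₁) :
    (ShortComplex.mk _ _ P.augmentation_comp_comp).Exact := by
  let φ : ShortComplex.mk _ _ P.augmentation_comp_comp ⟶ S :=
    { τ₁ := P.augmentation
      τ₂ := 𝟙 S.X₂
      τ₃ := 𝟙 S.X₃ }
  have : Epi φ.τ₁ := inferInstanceAs (Epi P.augmentation)
  have : IsIso φ.τ₂ := inferInstanceAs (IsIso (𝟙 S.X₂))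
  have : Mono φ.τ₃ := inferInstanceAs (Mono (𝟙 S.X₃))
  exact (ShortComplex.exact_iff_of_epi_of_isIso_of_mono φ).2 hS.exact

/-- The augmentation of `spliceComplex S P`. -/
noncomputable def spliceπ (P : ProjectiveResolution S.X₁) :
    spliceComplex S P ⟶ (ChainComplex.single₀ C).obj S.X₃ :=
  (ChainComplex.toSingle₀Equiv (spliceComplex S P) S.X₃).symm ⟨S.g, P.augmentation_comp_comp⟩

lemma spliceπ_f_zero (P : ProjectiveResolution S.X₁) : (spliceπ P).f 0 = S.g :=
  ChainComplex.toSingle₀Equiv_symm_apply_f_zero (C := spliceComplex S P) S.g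
    P.augmentation_comp_comp

/-- Splicing a projective resolution of the kernel of an epimorphism from a projective object. -/
noncomputable def splice (hS : S.ShortExact) [Projective S.X₂]
    (P : ProjectiveResolution S.X₁) : ProjectiveResolution S.X₃ where
  complex := spliceComplex S P
  projective n := match n with
    | 0 => (inferInstance : Projective S.X₂)
    | n + 1 => P.projective n
  π := spliceπ P
  quasiIso := ⟨fun n => by
    cases n
    · rw [ChainComplex.quasiIsoAt₀_iff, ShortComplex.quasiIso_iff_of_zeros']
      · refine (ShortComplex.exact_and_epi_g_iff_of_iso ?_).2
          ⟨exact_augmentation_comp hS P, hS.epi_g⟩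
        exact ShortComplex.isoMk (Iso.refl _) (Iso.refl _) (Iso.refl _)
          ((Category.id_comp _).trans (Category.comp_id _).symm)
          ((Category.id_comp S.g).trans
            ((spliceπ_f_zero P).symm.trans (Category.comp_id ((spliceπ P).f 0)).symm))
      all_goals rfl
    · rw [quasiIsoAt_iff_exactAt']
      · apply spliceComplex_exactAt_succ hS
      · apply ChainComplex.exactAt_succ_single_obj⟩

end CategoryTheory.ProjectiveResolution

section

variable {R : Type u} [CommRing R]

lemma HasProjDimLT.of_surjective {P M : Type u} [AddCommGroup P] [Module R P] [AddCommGroup M]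
    [Module R M] [Module.Projective R P] {g : P →ₗ[R] M} (hg : Function.Surjective g) {j : ℕ}
    (h : HasProjDimLT R (LinearMap.ker g) j) : HasProjDimLT R M (j + 1) := by
  obtain ⟨Q, hQ⟩ := h
  let S : ShortComplex (ModuleCat.{u} R) :=
    ShortComplex.mk (ModuleCat.ofHom (LinearMap.ker g).subtype) (ModuleCat.ofHom g)
      (by ext x; exact x.2)
  have hS : S.ShortExact :=
    { exact := (ShortComplex.ShortExact.moduleCat_exact_iff_function_exact _).2
        (LinearMap.exact_subtype_ker_map g)
      mono_f := (ModuleCat.mono_iff_injective _).2 (Submodule.injective_subtype _)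
      epi_g := (ModuleCat.epi_iff_surjective _).2 hg }
  have : Projective S.X₂ := (IsProjective.iff_projective P).1 inferInstance
  refine ⟨ProjectiveResolution.splice hS Q, fun n hn => ?_⟩
  obtain ⟨n, rfl⟩ := Nat.exists_eq_add_of_le' (Nat.one_le_of_lt hn)
  exact hQ n (Nat.le_of_succ_le_succ hn)

lemma HasProjDimLT.one_of_projective {M : Type u} [AddCommGroup M] [Module R M]
    [Module.Projective R M] : HasProjDimLT R M 1 := by
  have : Projective (ModuleCat.of R M) := (IsProjective.iff_projective M).1 inferInstance
  refine ⟨ProjectiveResolution.self _, fun n hn => ?_⟩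
  exact HomologicalComplex.isZero_single_obj_X _ _ _ _ (Nat.ne_of_gt hn)

lemma exact_lTensor_of_subsingleton_tor {M N : ModuleCat.{u} R} (Q : ProjectiveResolution N)
    (j : ℕ) (h : Subsingleton (((Tor (ModuleCat.{u} R) (j + 1)).obj M).obj N)) :
    Function.Exact ((Q.complex.d (j + 2) (j + 1)).hom.lTensor M)
      ((Q.complex.d (j + 1) j).hom.lTensor M) := by
  have h0 := ModuleCat.isZero_of_subsingleton (((Tor (ModuleCat.{u} R) (j + 1)).obj M).obj N)
  have h1 := h0.of_iso (Q.isoLeftDerivedObj ((MonoidalCategory.tensoringLeft _).obj M) (j + 1)).symm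
  have h2 := (HomologicalComplex.exactAt_iff_isZero_homology _ _).2 h1
  rw [HomologicalComplex.exactAt_iff' _ (j + 2) (j + 1) j (by simp) (by simp)] at h2
  exact (ShortComplex.ShortExact.moduleCat_exact_iff_function_exact _).1 h2

lemma lTensor_rTensor_comm_apply {M N P Q : Type*} [AddCommGroup M] [AddCommGroup N]
    [AddCommGroup P] [AddCommGroup Q] [Module R M] [Module R N] [Module R P] [Module R Q]
    (f : M →ₗ[R] P) (g : N →ₗ[R] Q) (x : TensorProduct R M N) :
    g.lTensor P (f.rTensor N x) = f.rTensor Q (g.lTensor M x) := by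
  rw [← LinearMap.comp_apply, ← LinearMap.comp_apply, LinearMap.lTensor_comp_rTensor,
    LinearMap.rTensor_comp_lTensor]

/-- The diagram chase behind dimension shifting for `Tor` in the first variable. -/
lemma mem_range_lTensor_of_exact {P M Q₀ Q₁ Q₂ : Type*} [AddCommGroup P] [Module R P]
    [AddCommGroup M] [Module R M] [AddCommGroup Q₀] [Module R Q₀] [AddCommGroup Q₁] [Module R Q₁]
    [AddCommGroup Q₂] [Module R Q₂] [Module.Flat R Q₀]
    {g : P →ₗ[R] M} (hg : Function.Surjective g) {d₁ : Q₁ →ₗ[R] Q₀} {d₂ : Q₂ →ₗ[R] Q₁}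
    (hd : d₁ ∘ₗ d₂ = 0) (hM : Function.Exact (d₂.lTensor M) (d₁.lTensor M))
    {x : TensorProduct R (LinearMap.ker g) Q₀}
    (hx : (LinearMap.ker g).subtype.rTensor Q₀ x ∈ LinearMap.range (d₁.lTensor P)) :
    x ∈ LinearMap.range (d₁.lTensor (LinearMap.ker g)) := by
  obtain ⟨y, hy⟩ := hx
  have hy' : d₁.lTensor M (g.rTensor Q₁ y) = 0 := by
    rw [lTensor_rTensor_comm_apply, hy]
    exact (rTensor_exact Q₀ (LinearMap.exact_subtype_ker_map g) hg).apply_apply_eq_zero x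
  obtain ⟨z, hz⟩ := (hM _).1 hy'
  obtain ⟨z', rfl⟩ := LinearMap.rTensor_surjective Q₂ hg z
  obtain ⟨w, hw⟩ := (rTensor_exact Q₁ (LinearMap.exact_subtype_ker_map g) hg
    (y - d₂.lTensor P z')).1 (by rw [map_sub, ← lTensor_rTensor_comm_apply, hz, sub_self])
  refine ⟨w, Module.Flat.rTensor_preserves_injective_linearMap (M := Q₀) _
    (LinearMap.ker g).injective_subtype ?_⟩
  have hd' : d₁.lTensor P (d₂.lTensor P z') = 0 := by
    rw [← LinearMap.comp_apply, ← LinearMap.lTensor_comp, hd, LinearMap.lTensor_zero,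
      LinearMap.zero_apply]
  rw [← lTensor_rTensor_comm_apply, hw, map_sub, hd', sub_zero, hy]

/-- Dimension shifting for `Tor` in the first variable. -/
lemma exact_lTensor_ker {P M Q₀ Q₁ Q₂ Q₃ : Type*} [AddCommGroup P] [Module R P]
    [AddCommGroup M] [Module R M] [AddCommGroup Q₀] [Module R Q₀] [AddCommGroup Q₁] [Module R Q₁]
    [AddCommGroup Q₂] [Module R Q₂] [AddCommGroup Q₃] [Module R Q₃] [Module.Flat R P]
    [Module.Flat R Q₁] {g : P →ₗ[R] M} (hg : Function.Surjective g) {d₁ : Q₁ →ₗ[R] Q₀}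
    {d₂ : Q₂ →ₗ[R] Q₁} {d₃ : Q₃ →ₗ[R] Q₂} (hd₁ : Function.Exact d₂ d₁) (hd₂ : d₂ ∘ₗ d₃ = 0)
    (hM : Function.Exact (d₃.lTensor M) (d₂.lTensor M)) :
    Function.Exact (d₂.lTensor (LinearMap.ker g)) (d₁.lTensor (LinearMap.ker g)) := by
  refine fun x => ⟨fun hx => ?_, ?_⟩
  · refine mem_range_lTensor_of_exact hg hd₂ hM ((Module.Flat.lTensor_exact P hd₁ _).1 ?_)
    rw [lTensor_rTensor_comm_apply, hx, map_zero]
  · rintro ⟨y, rfl⟩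
    rw [← LinearMap.comp_apply, ← LinearMap.lTensor_comp, hd₁.linearMap_comp_eq_zero,
      LinearMap.lTensor_zero, LinearMap.zero_apply]

lemma subsingleton_ker_tensorProduct {P M N Q₀ Q₁ Q₂ : Type*} [AddCommGroup P] [Module R P]
    [AddCommGroup M] [Module R M] [AddCommGroup N] [Module R N] [AddCommGroup Q₀] [Module R Q₀]
    [AddCommGroup Q₁] [Module R Q₁] [AddCommGroup Q₂] [Module R Q₂] [Module.Flat R Q₀]
    {g : P →ₗ[R] M} (hg : Function.Surjective g) {ε : Q₀ →ₗ[R] N} (hε : Function.Surjective ε)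
    {d₁ : Q₁ →ₗ[R] Q₀} {d₂ : Q₂ →ₗ[R] Q₁} (hd₁ : Function.Exact d₁ ε) (hd₂ : d₁ ∘ₗ d₂ = 0)
    (hM : Function.Exact (d₂.lTensor M) (d₁.lTensor M))
    (hN : (LinearMap.ker g).subtype.rTensor N = 0) :
    Subsingleton (TensorProduct R (LinearMap.ker g) N) := by
  refine subsingleton_of_forall_eq 0 fun t => ?_
  obtain ⟨x, rfl⟩ := LinearMap.lTensor_surjective (LinearMap.ker g) hε t
  refine (lTensor_exact (LinearMap.ker g) hd₁ hε x).2
    (mem_range_lTensor_of_exact hg hd₂ hM ((lTensor_exact P hd₁ hε _).1 ?_))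
  rw [lTensor_rTensor_comm_apply, hN, LinearMap.zero_apply]

lemma Submodule.eq_top_of_sup_smul_eq_top {I : Ideal R} (hI : IsNilpotent I) {M : Type*}
    [AddCommGroup M] [Module R M] {N : Submodule R M} (h : N ⊔ I • ⊤ = ⊤) : N = ⊤ := by
  obtain ⟨n, hn⟩ := hI
  have key (k : ℕ) : N ⊔ I ^ k • ⊤ = ⊤ := by
    induction k with
    | zero => simp
    | succ k ih =>
      rw [eq_top_iff]
      calc ⊤ = N ⊔ I • (N ⊔ I ^ k • ⊤) := by rw [ih, h]
        _ ≤ N ⊔ I ^ (k + 1) • ⊤ := by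
          rw [Submodule.smul_sup, pow_succ', Submodule.mul_smul, ← sup_assoc]
          exact sup_le_sup_right (sup_le le_rfl Submodule.smul_le_right) _
  simpa [hn] using key n

lemma rTensor_subtype_eq_zero {I : Ideal R} {P N : Type*} [AddCommGroup P] [Module R P]
    [AddCommGroup N] [Module R N] (hN : Module.IsTorsionBySet R N I) {K : Submodule R P}
    (hK : K ≤ I • ⊤) : K.subtype.rTensor N = 0 := by
  ext ⟨k, hk⟩ n
  suffices I • ⊤ ≤ LinearMap.ker ((TensorProduct.mk R P N).flip n) from this (hK hk)
  rw [Submodule.smul_le]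
  intro a ha p _
  have : a • n = 0 := @hN n ⟨a, ha⟩
  rw [LinearMap.mem_ker, LinearMap.flip_apply, TensorProduct.mk_apply, TensorProduct.smul_tmul,
    this, TensorProduct.tmul_zero]

variable [IsLocalRing R]

open IsLocalRing

lemma subsingleton_of_subsingleton_tensorProduct (hm : IsNilpotent (maximalIdeal R))
    {K N : Type*} [AddCommGroup K] [Module R K] [AddCommGroup N] [Module R N] [Nontrivial N]
    (hN : Module.IsTorsionBySet R N (maximalIdeal R)) [Subsingleton (TensorProduct R K N)] :
    Subsingleton K := by
  let _ : Module (ResidueField R) N := hN.module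
  have : IsScalarTower R (ResidueField R) N := hN.isScalarTower
  obtain ⟨x, hx⟩ := exists_ne (0 : N)
  obtain ⟨l, hl⟩ := Module.Projective.exists_dual_eq_one (ResidueField R) hx
  have hsurj : Function.Surjective (l.restrictScalars R) := fun c =>
    ⟨c • x, by simp [hl]⟩
  have : Subsingleton (TensorProduct R K (R ⧸ maximalIdeal R)) :=
    (LinearMap.lTensor_surjective K hsurj).subsingleton
  have : Subsingleton (K ⧸ (maximalIdeal R • ⊤ : Submodule R K)) :=
    (TensorProduct.tensorQuotEquivQuotSMul K (maximalIdeal R)).symm.injective.subsingleton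
  have h := Submodule.Quotient.subsingleton_iff.1 this
  have hbot : (⊥ : Submodule R K) = ⊤ :=
    Submodule.eq_top_of_sup_smul_eq_top hm (by rw [h, bot_sup_eq])
  exact (Submodule.subsingleton_iff R).1 (subsingleton_of_bot_eq_top hbot)

lemma exists_minimal_cover_of_surjective (hm : IsNilpotent (maximalIdeal R)) {M V : Type u}
    [AddCommGroup M] [Module R M] [AddCommGroup V] [Module R V] [Module (ResidueField R) V]
    [IsScalarTower R (ResidueField R) V] {π : M →ₗ[R] V} (hπ : Function.Surjective π)
    (hker : LinearMap.ker π ≤ maximalIdeal R • ⊤) :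
    ∃ (ι : Type u) (g : (ι →₀ R) →ₗ[R] M), Function.Surjective g ∧
      LinearMap.ker g ≤ maximalIdeal R • ⊤ := by
  let b := Module.Basis.ofVectorSpace (ResidueField R) V
  choose v hv using fun i => hπ (b i)
  have hcomp (c) : π (Finsupp.linearCombination R v c) =
      Finsupp.linearCombination (ResidueField R) b (c.mapRange (residue R) (map_zero _)) := by
    rw [Finsupp.linearCombination_apply, Finsupp.linearCombination_apply,
      Finsupp.sum_mapRange_index (by simp), map_finsuppSum]
    refine Finsupp.sum_congr fun i _ => ?_
    rw [map_smul, hv]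
    exact (algebraMap_smul (ResidueField R) (c i) (b i)).symm
  refine ⟨_, Finsupp.linearCombination R v, ?_, fun c hc => ?_⟩
  · rw [← LinearMap.range_eq_top]
    refine Submodule.eq_top_of_sup_smul_eq_top hm (eq_top_iff.2 fun x _ => ?_)
    obtain ⟨c, hc⟩ := Finsupp.mapRange_surjective (α := Module.Basis.ofVectorSpaceIndex _ V)
      (residue R) (map_zero _) residue_surjective (b.repr (π x))
    have hx : π (x - Finsupp.linearCombination R v c) = 0 := by
      rw [map_sub, hcomp, hc, b.linearCombination_repr, sub_self]
    rw [← sub_add_cancel x (Finsupp.linearCombination R v c), add_comm]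
    exact Submodule.add_mem_sup ⟨c, rfl⟩ (hker hx)
  · have h0 := hcomp c
    rw [LinearMap.mem_ker.1 hc, map_zero] at h0
    have h1 := b.linearIndependent (h0.symm.trans (map_zero _).symm)
    rw [← Finsupp.sum_single c]
    refine Submodule.sum_mem _ fun i _ => ?_
    have hi : c i ∈ maximalIdeal R := (residue_eq_zero_iff _).1 (DFunLike.congr_fun h1 i)
    simpa using Submodule.smul_mem_smul hi
      (Submodule.mem_top : (Finsupp.single i 1 : _ →₀ R) ∈ ⊤)

lemma exists_minimal_cover (hm : IsNilpotent (maximalIdeal R)) (M : Type u) [AddCommGroup M]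
    [Module R M] : ∃ (ι : Type u) (g : (ι →₀ R) →ₗ[R] M), Function.Surjective g ∧
      LinearMap.ker g ≤ maximalIdeal R • ⊤ := by
  have hV := Module.isTorsionBySet_quotient_ideal_smul M (maximalIdeal R)
  let _ : Module (ResidueField R) (M ⧸ (maximalIdeal R • ⊤ : Submodule R M)) := hV.module
  have : IsScalarTower R (ResidueField R) (M ⧸ (maximalIdeal R • ⊤ : Submodule R M)) :=
    hV.isScalarTower
  exact exists_minimal_cover_of_surjective hm (Submodule.mkQ_surjective _) (Submodule.ker_mkQ _).le

lemma hasProjDimLT_of_exact (hm : IsNilpotent (maximalIdeal R)) {N : ModuleCat.{u} R}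
    [Nontrivial N] (hN : Module.IsTorsionBySet R N (maximalIdeal R))
    (Q : ProjectiveResolution N) (j : ℕ) (M : Type u) [AddCommGroup M] [Module R M]
    (h : Function.Exact ((Q.complex.d (j + 2) (j + 1)).hom.lTensor M)
      ((Q.complex.d (j + 1) j).hom.lTensor M)) : HasProjDimLT R M (j + 1) := by
  have hflat (n : ℕ) : Module.Flat R (Q.complex.X n) := by
    have : Module.Projective R (Q.complex.X n) :=
      (IsProjective.iff_projective _).2 (Q.projective n)
    infer_instance
  have hd (n : ℕ) : (Q.complex.d (n + 1) n).hom ∘ₗ (Q.complex.d (n + 2) (n + 1)).hom = 0 := by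
    rw [← ModuleCat.hom_comp, Q.complex.d_comp_d, ModuleCat.hom_zero]
  have hexQ (n : ℕ) : Function.Exact (Q.complex.d (n + 2) (n + 1)).hom
      (Q.complex.d (n + 1) n).hom :=
    (ShortComplex.ShortExact.moduleCat_exact_iff_function_exact _).1
    (Q.exact_succ n)
  have hex₀ : Function.Exact (Q.complex.d 1 0).hom Q.augmentation.hom :=
    (ShortComplex.ShortExact.moduleCat_exact_iff_function_exact _).1
    Q.exact_augmentation
  have hsurj : Function.Surjective Q.augmentation.hom :=
    (ModuleCat.epi_iff_surjective _).1 inferInstance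
  induction j generalizing M with
  | zero =>
    obtain ⟨ι, g, hg, hker⟩ := exists_minimal_cover hm M
    have := subsingleton_ker_tensorProduct hg hsurj hex₀ (hd 0) h
      (rTensor_subtype_eq_zero hN hker)
    have := subsingleton_of_subsingleton_tensorProduct (K := LinearMap.ker g) hm hN
    have hinj : Function.Injective g :=
      LinearMap.ker_eq_bot.1 (Submodule.subsingleton_iff_eq_bot.1 this)
    have := Module.Projective.of_equiv (LinearEquiv.ofBijective g ⟨hinj, hg⟩)
    exact HasProjDimLT.one_of_projective
  | succ j ih =>
    have hg := Finsupp.linearCombination_id_surjective R M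
    exact HasProjDimLT.of_surjective hg
      (ih _ (exact_lTensor_ker hg (hexQ j) (hd (j + 1)) h))

end

/-- Let `(R, m)` be an Artinian local commutative ring of prime
characteristic `p` with `m^p = 0`.  If `M` is an arbitrary `R`-module with
`Tor^R_j(M, ^{φ^r}R) = 0` for some `j, r ≥ 1`, then `M` has projective dimension `< j`. -/
theorem stmt5 {R : Type u} [CommRing R] [IsArtinianRing R] [IsLocalRing R]
    (p : ℕ) (hp : p.Prime) [CharP R p]
    (hmp : IsLocalRing.maximalIdeal R ^ p = ⊥)
    (M : Type u) [AddCommGroup M] [Module R M]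
    (j r : ℕ) (hj : 1 ≤ j) (hr : 1 ≤ r)
    (f : R →+* R) (hf : ∀ a, f a = a ^ p ^ r)
    (htor : Subsingleton
      (((Tor (ModuleCat.{u} R) j).obj (ModuleCat.of R M)).obj (frobMod f))) :
    HasProjDimLT R M j := by
  have hm : IsNilpotent (IsLocalRing.maximalIdeal R) := ⟨p, hmp⟩
  obtain ⟨j, rfl⟩ := Nat.exists_eq_add_of_le' hj
  have hN : Module.IsTorsionBySet R (frobMod f) (IsLocalRing.maximalIdeal R) := by
    intro x a
    have ha : f a = 0 := by
      have h : (a : R) ^ p = 0 := by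
        simpa [hmp] using Ideal.pow_mem_pow a.2 p
      rw [hf]
      exact pow_eq_zero_of_le (Nat.le_self_pow (by lia) p) h
    exact (ModuleCat.restrictScalars.smul_def f (a : R) x).trans
      (by rw [ha]; exact zero_mul (M₀ := R) x)
  have : Nontrivial (frobMod f) := inferInstanceAs (Nontrivial R)
  exact hasProjDimLT_of_exact hm hN (ProjectiveResolution.of _) j M
    (exact_lTensor_of_subsingleton_tor _ j htor)
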